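/- arXiv:1403.6986 — 2 statements merged into one kernel-verified Lean document; each statement's English description precedes it below -/
import Mathlib

section
/- In (ℝ³, q) with q(x) = max{x₁, x₂, x₃, 0}, let A := {(x₁, 0, x₃) : x₁² + x₃² = 1, 0 < x₁ ≤ 1, x₃ ≥ 0} and K := co(A ∪ {(0,0,0), (0,1,1)}). Then K is not strongly q-compact: there is no set K₀ compact in the Euclidean topology with K₀ ⊆ K ⊆ K₀ + θ₀. In particular, in dimension 3 there exist q-compact convex sets that are not strongly q-compact. -/
open Set Pointwise

/-- The topology on `X` induced by the asymmetric "norm" `q`: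
`U` is open iff around each of its points it contains a forward ball `{y | q (y - x) < ε}`. -/
def ballTop {X : Type*} [Sub X] (q : X → ℝ) : TopologicalSpace X where
  IsOpen U := ∀ x ∈ U, ∃ ε > 0, ∀ y, q (y - x) < ε → y ∈ U
  isOpen_univ := fun _ _ => ⟨1, one_pos, fun _ _ => trivial⟩
  isOpen_inter := fun U V hU hV x hx => by
    obtain ⟨ε₁, hε₁, h₁⟩ := hU x hx.1
    obtain ⟨ε₂, hε₂, h₂⟩ := hV x hx.2
    exact ⟨min ε₁ ε₂, lt_min hε₁ hε₂, fun y hy =>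
      ⟨h₁ y (hy.trans_le (min_le_left _ _)), h₂ y (hy.trans_le (min_le_right _ _))⟩⟩
  isOpen_sUnion := fun S hS x hx => by
    obtain ⟨U, hUS, hxU⟩ := hx
    obtain ⟨ε, hε, h⟩ := hS U hUS x hxU
    exact ⟨ε, hε, fun y hy => ⟨U, hUS, h y hy⟩⟩

/-- The asymmetric lattice norm `q(x) = max {x₁, x₂, x₃, 0}` on `ℝ³`. -/
def q3 : (Fin 3 → ℝ) → ℝ := fun x => max (x 0) (max (x 1) (max (x 2) 0))

/-- The quarter circle `A = {(x₁, 0, x₃) : x₁² + x₃² = 1, 0 < x₁ ≤ 1, x₃ ≥ 0}`. -/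
def A3 : Set (Fin 3 → ℝ) :=
  {x | x 1 = 0 ∧ (x 0) ^ 2 + (x 2) ^ 2 = 1 ∧ 0 < x 0 ∧ x 0 ≤ 1 ∧ 0 ≤ x 2}

/-- `K = co (A ∪ {(0,0,0), (0,1,1)})`. -/
def K3 : Set (Fin 3 → ℝ) :=
  convexHull ℝ (A3 ∪ {![0, 0, 0], ![0, 1, 1]})

lemma q3_lt_iff {x : Fin 3 → ℝ} {ε : ℝ} (hε : 0 < ε) : q3 x < ε ↔ ∀ i, x i < ε := by
  simp [q3, Fin.forall_fin_succ, hε]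

lemma q3_eq_zero_iff {x : Fin 3 → ℝ} : q3 x = 0 ↔ ∀ i, x i ≤ 0 := by
  have h : 0 ≤ q3 x := by simp [q3]
  rw [← h.ge_iff_eq']
  simp [q3, Fin.forall_fin_succ]

lemma isOpen_of_isOpen_ballTop_q3 {U : Set (Fin 3 → ℝ)} (hU : @IsOpen _ (ballTop q3) U) :
    IsOpen U := by
  refine Metric.isOpen_iff.2 fun x hx => ?_
  obtain ⟨ε, hε, h⟩ := hU x hx
  refine ⟨ε, hε, fun y hy => h y ((q3_lt_iff hε).2 fun i => ?_)⟩
  have := (dist_pi_lt_iff hε).1 (Metric.mem_ball.1 hy) i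
  exact (le_abs_self _).trans_lt this

/-- A set is `q`-compact if each point of some compact superset lies below one of its points. -/
lemma isCompact_ballTop_q3 {K L : Set (Fin 3 → ℝ)} (hL : IsCompact L) (hKL : K ⊆ L)
    (h : ∀ x ∈ L, ∃ y ∈ K, x ≤ y) : @IsCompact _ (ballTop q3) K := by
  refine (@isCompact_iff_finite_subcover _ (ballTop q3) K).2 fun {ι} U hU hKU => ?_
  obtain ⟨t, ht⟩ := hL.elim_finite_subcover U (fun i => isOpen_of_isOpen_ballTop_q3 (hU i))
    fun x hx => by
      obtain ⟨y, hy, hxy⟩ := h x hx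
      obtain ⟨i, hi⟩ := mem_iUnion.1 (hKU hy)
      obtain ⟨ε, hε, hball⟩ := hU i y hi
      refine mem_iUnion.2 ⟨i, hball x ((q3_lt_iff hε).2 fun j => ?_)⟩
      have := hxy j
      simp only [Pi.sub_apply]
      linarith
  exact ⟨t, hKL.trans ht⟩

/-- The closure of `K3`, described by inequalities. -/
def K3bar : Set (Fin 3 → ℝ) :=
  {x | 0 ≤ x 0 ∧ 0 ≤ x 1 ∧ x 1 ≤ x 2 ∧ x 1 ≤ 1 ∧ x 0 ^ 2 + (x 2 - x 1) ^ 2 ≤ (1 - x 1) ^ 2}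

lemma convex_K3bar : Convex ℝ K3bar := by
  rintro u ⟨hu0, hu1, hu2, hu3, hu4⟩ v ⟨hv0, hv1, hv2, hv3, hv4⟩ a b ha hb hab
  obtain rfl : b = 1 - a := by linarith
  have hcs : u 0 * v 0 + (u 2 - u 1) * (v 2 - v 1) ≤ (1 - u 1) * (1 - v 1) := by
    refine le_of_sq_le_sq ?_ (mul_nonneg (by linarith) (by linarith))
    have := mul_le_mul hu4 hv4 (by positivity) (by positivity)
    nlinarith [sq_nonneg (u 0 * (v 2 - v 1) - v 0 * (u 2 - u 1))]
  simp only [K3bar, mem_ofPred_eq, Pi.add_apply, Pi.smul_apply, smul_eq_mul]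
  refine ⟨by positivity, by positivity, by nlinarith, by nlinarith, ?_⟩
  nlinarith [mul_le_mul_of_nonneg_left hcs (mul_nonneg ha hb),
    mul_le_mul_of_nonneg_left hu4 (mul_nonneg ha ha),
    mul_le_mul_of_nonneg_left hv4 (mul_nonneg hb hb)]

lemma isCompact_K3bar : IsCompact K3bar := by
  refine (isCompact_Icc (a := (0 : Fin 3 → ℝ)) (b := 1)).of_isClosed_subset ?_ ?_
  · simp only [K3bar, ofPred_and]
    exact (isClosed_le (by fun_prop) (by fun_prop)).inter <|
      (isClosed_le (by fun_prop) (by fun_prop)).inter <|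
      (isClosed_le (by fun_prop) (by fun_prop)).inter <|
      (isClosed_le (by fun_prop) (by fun_prop)).inter <|
      isClosed_le (by fun_prop) (by fun_prop)
  · rintro x ⟨h0, h1, h2, h3, h4⟩
    refine ⟨fun i => ?_, fun i => ?_⟩ <;> fin_cases i <;>
      simp only [Pi.zero_apply, Pi.one_apply, Fin.zero_eta, Fin.mk_one, Fin.reduceFinMk] <;>
      nlinarith

lemma mem_K3_iff {x : Fin 3 → ℝ} : x ∈ K3 ↔ x ∈ K3bar ∧ (x 0 = 0 → x 2 = x 1) := by
  constructor
  · suffices K3 ⊆ {x | x ∈ K3bar ∧ (x 0 = 0 → x 2 = x 1)} from fun h => this h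
    refine convexHull_min ?_ ?_
    · rintro x (⟨h1, h2, h3, h4, h5⟩ | rfl | rfl)
      · exact ⟨⟨h3.le, h1.ge, h1.trans_le h5, by linarith, by rw [h1]; linarith⟩,
          fun h => absurd h h3.ne'⟩
      · simp [K3bar]
      · simp [K3bar]
    · rintro u ⟨hu, hu'⟩ v ⟨hv, hv'⟩ a b ha hb hab
      refine ⟨convex_K3bar hu hv ha hb hab, fun h => ?_⟩
      simp only [Pi.add_apply, Pi.smul_apply, smul_eq_mul] at h ⊢
      obtain ⟨h1, h2⟩ := (add_eq_zero_iff_of_nonneg (mul_nonneg ha hu.1)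
        (mul_nonneg hb hv.1)).1 h
      have e1 : a * u 2 = a * u 1 := by
        rcases mul_eq_zero.1 h1 with h | h
        · simp [h]
        · rw [hu' h]
      have e2 : b * v 2 = b * v 1 := by
        rcases mul_eq_zero.1 h2 with h | h
        · simp [h]
        · rw [hv' h]
      rw [e1, e2]
  · rintro ⟨⟨h0, h1, h2, h3, h4⟩, h5⟩
    have hconv : Convex ℝ K3 := convex_convexHull ℝ _
    have hz : ![0, 0, 0] ∈ K3 := subset_convexHull ℝ _ (Or.inr (Or.inl rfl))
    have hp : ![0, 1, 1] ∈ K3 := subset_convexHull ℝ _ (Or.inr (Or.inr rfl))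
    rcases h0.eq_or_lt with h | h
    · convert hconv hz hp (sub_nonneg.2 h3) h1 (sub_add_cancel _ _) using 1
      ext i
      fin_cases i <;> simp [← h, h5 h.symm]
    · set r := √(x 0 ^ 2 + (x 2 - x 1) ^ 2) with hr
      have hr0 : 0 < r := Real.sqrt_pos.2 (by positivity)
      have hr2 : r ^ 2 = x 0 ^ 2 + (x 2 - x 1) ^ 2 := Real.sq_sqrt (by positivity)
      have hr1 : r ≤ 1 - x 1 := Real.sqrt_le_iff.2 ⟨by linarith, h4⟩
      have hA : ![x 0 / r, 0, (x 2 - x 1) / r] ∈ K3 := by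
        refine subset_convexHull ℝ _ (Or.inl ⟨rfl, ?_, ?_, ?_, ?_⟩)
        · simp only [Matrix.cons_val]
          field_simp
          exact hr2.symm
        · exact div_pos h hr0
        · exact (div_le_one hr0).2 (Real.le_sqrt_of_sq_le (by nlinarith))
        · exact div_nonneg (by linarith) hr0.le
      have hsum := hconv.sum_mem (t := Finset.univ) (w := ![1 - x 1 - r, r, x 1])
        (z := ![![0, 0, 0], ![x 0 / r, 0, (x 2 - x 1) / r], ![0, 1, 1]])
        (fun i _ => by fin_cases i <;> simp <;> linarith)
        (by simp [Fin.sum_univ_three])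
        (fun i _ => by fin_cases i <;> simpa)
      convert hsum using 1
      ext i
      fin_cases i <;> simp [Fin.sum_univ_three] <;> field_simp
      ring

lemma isCompact_ballTop_K3 : @IsCompact _ (ballTop q3) K3 := by
  refine isCompact_ballTop_q3 isCompact_K3bar (fun x hx => (mem_K3_iff.1 hx).1) fun x hx => ?_
  by_cases h : x 0 = 0
  · refine ⟨![0, 1, 1], subset_convexHull ℝ _ (Or.inr (Or.inr rfl)), fun i => ?_⟩
    obtain ⟨h0, h1, h2, h3, h4⟩ := hx
    fin_cases i <;> simp <;> nlinarith
  · exact ⟨x, mem_K3_iff.2 ⟨hx, fun h' => absurd h' h⟩, le_rfl⟩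

/-- The points of the arc `A3` are maximal in `K3`. -/
lemma eq_of_mem_A3_of_le {x y : Fin 3 → ℝ} (hx : x ∈ A3) (hy : y ∈ K3) (hxy : x ≤ y) :
    x = y := by
  obtain ⟨hx1, hx2, hx3, hx4, hx5⟩ := hx
  obtain ⟨⟨h0, h1, h2, h3, h4⟩, -⟩ := mem_K3_iff.1 hy
  have l0 := hxy 0
  have l2 := hxy 2
  have y2 : y 2 < 1 := by nlinarith
  have y1 : y 1 = 0 := by nlinarith
  rw [y1] at h4
  ext i
  fin_cases i <;> simp only [Fin.zero_eta, Fin.mk_one, Fin.reduceFinMk]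
  · nlinarith
  · rw [hx1, y1]
  · nlinarith

lemma mem_closure_A3 : ![0, 0, 1] ∈ closure A3 := by
  have hc : Continuous fun t : ℝ => ![Real.sin t, 0, Real.cos t] := by fun_prop
  have hm := hc.continuousWithinAt.mem_closure (s := Ioo 0 1) (x := 0) (t := A3)
    (by rw [closure_Ioo zero_ne_one]; simp) fun t ht => ?_
  · simpa using hm
  · have hpi := Real.pi_gt_three
    exact ⟨rfl, Real.sin_sq_add_cos_sq t, Real.sin_pos_of_pos_of_lt_pi ht.1 (by linarith [ht.2]),
      Real.sin_le_one t, Real.cos_nonneg_of_mem_Icc ⟨by linarith [ht.1], by linarith [ht.2]⟩⟩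

lemma not_strongly_compact_K3 : ¬ ∃ K₀ : Set (Fin 3 → ℝ), IsCompact K₀ ∧ K₀ ⊆ K3 ∧
    K3 ⊆ K₀ + {x : Fin 3 → ℝ | q3 x = 0} := by
  rintro ⟨K₀, hK, hsub, hsup⟩
  have hA : A3 ⊆ K₀ := fun x hx => by
    obtain ⟨y, hy, z, hz, rfl⟩ := hsup (subset_convexHull ℝ _ (Or.inl hx))
    have hle : y + z ≤ y := fun i => by
      simpa using q3_eq_zero_iff.1 hz i
    simpa only [eq_of_mem_A3_of_le hx (hsub hy) hle] using hy
  have hmem := hsub (hK.isClosed.closure_subset_iff.2 hA mem_closure_A3)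
  simpa using (mem_K3_iff.1 hmem).2 rfl

/-- The set `K = co (A ∪ {(0,0,0), (0,1,1)})` is not strongly `q`-compact in `(ℝ³, q)`;
in particular, in dimension `3` there are `q`-compact convex sets that are not strongly
`q`-compact. -/
theorem K3_not_strongly_qCompact :
    (¬ ∃ K₀ : Set (Fin 3 → ℝ), IsCompact K₀ ∧ K₀ ⊆ K3 ∧
        K3 ⊆ K₀ + {x : Fin 3 → ℝ | q3 x = 0}) ∧
    ∃ S : Set (Fin 3 → ℝ), Convex ℝ S ∧ @IsCompact _ (ballTop q3) S ∧
      ¬ ∃ K₀ : Set (Fin 3 → ℝ), IsCompact K₀ ∧ K₀ ⊆ S ∧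
          S ⊆ K₀ + {x : Fin 3 → ℝ | q3 x = 0} := by
  exact ⟨not_strongly_compact_K3, K3, convex_convexHull ℝ _, isCompact_ballTop_K3,
    not_strongly_compact_K3⟩
end

section
/- Let K ⊆ ℝ² be a nonempty q-compact convex set with (α,v) ≠ (u,β). Then R_K equals the convex hull of F_K, and if moreover K has nonempty interior in the q-topology, then S_K := K ∩ (ℝ × [β,∞)) ∩ ([α,∞) × ℝ) equals the convex hull of F_K ∪ {(α,β)}. -/
open Set Pointwise

/-- The asymmetric lattice norm on `ℝ²` induced by a lattice norm `N`: `q x = N (x ∨ 0)`. -/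
def q2 (N : ℝ × ℝ → ℝ) : ℝ × ℝ → ℝ := fun x => N (max x.1 0, max x.2 0)

/-- `θ₀ = {x | q x = 0}`. -/
def theta0 (N : ℝ × ℝ → ℝ) : Set (ℝ × ℝ) := {x | q2 N x = 0}

/-- Translate of a set of `ℝ²` by a vector. -/
def transl (a : ℝ × ℝ) (S : Set (ℝ × ℝ)) : Set (ℝ × ℝ) := (a + ·) '' S

/-- The interior of `θ₀` with respect to the `q`-topology. -/
def thetaIntQ (N : ℝ × ℝ → ℝ) : Set (ℝ × ℝ) :=
  @interior _ (ballTop (q2 N)) (theta0 N)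

section

variable {N : ℝ × ℝ → ℝ}

theorem ballTop_q2_isOpen
    (hN0 : ∀ x : ℝ × ℝ, N x = 0 ↔ x = 0)
    (hNs : ∀ (c : ℝ) (x : ℝ × ℝ), N (c • x) = |c| * N x)
    (hNl : ∀ x y : ℝ × ℝ, |x.1| ≤ |y.1| → |x.2| ≤ |y.2| → N x ≤ N y)
    {U : Set (ℝ × ℝ)} (hU : IsOpen U) (hlow : IsLowerSet U) :
    @IsOpen _ (ballTop (q2 N)) U := by
  have hpos : ∀ x : ℝ × ℝ, x ≠ 0 → 0 < N x := fun x hx => by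
    refine lt_of_le_of_ne ?_ fun h => hx ((hN0 x).1 h.symm)
    rw [← (hN0 0).2 rfl]
    exact hNl 0 x (by simp) (by simp)
  have h₁ : 0 < N (1, 0) := hpos _ (by simp)
  have h₂ : 0 < N (0, 1) := hpos _ (by simp)
  intro x hx
  obtain ⟨δ, hδ, hball⟩ := Metric.isOpen_iff.1 hU x hx
  refine ⟨δ * min (N (1, 0)) (N (0, 1)), by positivity, fun y hy => ?_⟩
  have e₁ : max (y.1 - x.1) 0 * N (1, 0) ≤ q2 N (y - x) := by
    have := hNs (max (y.1 - x.1) 0) (1, 0)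
    rw [abs_of_nonneg (le_max_right _ _)] at this
    rw [← this]
    exact hNl _ _ (by simp) (by simp)
  have e₂ : max (y.2 - x.2) 0 * N (0, 1) ≤ q2 N (y - x) := by
    have := hNs (max (y.2 - x.2) 0) (0, 1)
    rw [abs_of_nonneg (le_max_right _ _)] at this
    rw [← this]
    exact hNl _ _ (by simp) (by simp)
  have l₁ : max (y.1 - x.1) 0 < δ :=
    lt_of_mul_lt_mul_right (e₁.trans_lt (hy.trans_le
      (mul_le_mul_of_nonneg_left (min_le_left _ _) hδ.le))) h₁.le
  have l₂ : max (y.2 - x.2) 0 < δ :=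
    lt_of_mul_lt_mul_right (e₂.trans_lt (hy.trans_le
      (mul_le_mul_of_nonneg_left (min_le_right _ _) hδ.le))) h₂.le
  have hz : (x.1 + max (y.1 - x.1) 0, x.2 + max (y.2 - x.2) 0) ∈ U := by
    refine hball ?_
    rw [Metric.mem_ball, Prod.dist_eq, Real.dist_eq, Real.dist_eq]
    simp [abs_of_nonneg, l₁, l₂]
  refine hlow ⟨?_, ?_⟩ hz
  · linarith [le_max_left (y.1 - x.1) 0]
  · linarith [le_max_left (y.2 - x.2) 0]

theorem exists_max_of_isCompact_ballTop_q2
    (hN0 : ∀ x : ℝ × ℝ, N x = 0 ↔ x = 0)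
    (hNs : ∀ (c : ℝ) (x : ℝ × ℝ), N (c • x) = |c| * N x)
    (hNl : ∀ x y : ℝ × ℝ, |x.1| ≤ |y.1| → |x.2| ≤ |y.2| → N x ≤ N y)
    {K : Set (ℝ × ℝ)} (hne : K.Nonempty) (hcomp : @IsCompact _ (ballTop (q2 N)) K)
    {f : ℝ × ℝ → ℝ} (hf : Continuous f) (hmono : Monotone f) :
    ∃ k ∈ K, ∀ x ∈ K, f x ≤ f k := by
  have hopen : ∀ c, @IsOpen _ (ballTop (q2 N)) {x | f x < c} := fun c =>
    ballTop_q2_isOpen hN0 hNs hNl (isOpen_lt hf continuous_const)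
      fun x y hyx hx => (hmono hyx).trans_lt hx
  let _ := ballTop (q2 N)
  have husc : UpperSemicontinuous f := upperSemicontinuous_iff_isOpen_preimage.2 hopen
  obtain ⟨k, hk, hmax⟩ := (husc.upperSemicontinuousOn K).exists_isMaxOn hne hcomp
  exact ⟨k, hk, hmax⟩

/-- A set with nonempty `q`-interior contains a whole quadrant. -/
theorem exists_Iic_subset_of_interior_ballTop_q2 (hN0 : ∀ x : ℝ × ℝ, N x = 0 ↔ x = 0)
    {K : Set (ℝ × ℝ)} (h : (@interior _ (ballTop (q2 N)) K).Nonempty) :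
    ∃ x, Iic x ⊆ K := by
  obtain ⟨x, hx⟩ := h
  obtain ⟨ε, hε, hsub⟩ := @isOpen_interior _ (ballTop (q2 N)) K x hx
  refine ⟨x, fun y hy => @interior_subset _ (ballTop (q2 N)) K y (hsub y ?_)⟩
  have : q2 N (y - x) = 0 := (hN0 _).2 (by
    ext
    · simpa using hy.1
    · simpa using hy.2)
  rwa [this]

end

theorem Convex.combo_three_mem {E : Type*} [AddCommGroup E] [Module ℝ E] {s : Set E}
    (hs : Convex ℝ s) {x y z : E} (hx : x ∈ s) (hy : y ∈ s) (hz : z ∈ s) {r t w : ℝ}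
    (hr : 0 ≤ r) (ht : 0 ≤ t) (hw : 0 ≤ w) (h : r + t + w = 1) :
    r • x + t • y + w • z ∈ s := by
  have := hs.sum_mem (t := Finset.univ) (w := ![r, t, w]) (z := ![x, y, z])
    (fun i _ => by fin_cases i <;> simpa) (by simpa [Fin.sum_univ_three] using h)
    (fun i _ => by fin_cases i <;> simpa)
  simpa [Fin.sum_univ_three] using this

theorem IsPreconnected.inter_frontier_nonempty {X : Type*} [TopologicalSpace X] {s t : Set X}
    (ht : IsPreconnected t) (h₁ : (t ∩ s).Nonempty) (h₂ : (t ∩ sᶜ).Nonempty) :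
    (t ∩ frontier s).Nonempty := by
  by_contra hempty
  have hnot : ∀ x ∈ t, x ∉ frontier s := fun x hx hf => hempty ⟨x, hx, hf⟩
  have hint : ∀ x ∈ t, x ∈ closure s → x ∈ interior s := fun x hx hc => by
    by_contra h
    exact hnot x hx ⟨hc, h⟩
  obtain ⟨x, hxt, hxs⟩ := h₁
  obtain ⟨y, hyt, hys⟩ := h₂
  obtain ⟨z, -, hz₁, hz₂⟩ := ht (interior s) (closure s)ᶜ isOpen_interior
    isClosed_closure.isOpen_compl
    (fun z hz => or_iff_not_imp_right.2 fun h => hint z hz (not_not.1 h))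
    ⟨x, hxt, hint x hxt (subset_closure hxs)⟩
    ⟨y, hyt, fun h => hys (interior_subset (hint y hyt h))⟩
  exact hz₂ (subset_closure (interior_subset hz₁))

theorem Bornology.IsBounded.exists_add_smul_mem_frontier {E : Type*} [NormedAddCommGroup E]
    [NormedSpace ℝ E] {s : Set E} (hs : Bornology.IsBounded s) {p d : E} (hp : p ∈ s)
    (hd : d ≠ 0) : ∃ t : ℝ, 0 ≤ t ∧ p + t • d ∈ frontier s := by
  have hpre : IsPreconnected ((fun t : ℝ => p + t • d) '' Ici 0) :=
    isPreconnected_Ici.image _ (by fun_prop)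
  obtain ⟨C, hC⟩ := hs.exists_norm_le
  have hdn : 0 < ‖d‖ := norm_pos_iff.2 hd
  have hC0 : 0 ≤ C := (norm_nonneg p).trans (hC p hp)
  have hout : ((fun t : ℝ => p + t • d) '' Ici 0 ∩ sᶜ).Nonempty := by
    have ht : 0 ≤ (2 * C + 1) / ‖d‖ := by positivity
    refine ⟨_, ⟨(2 * C + 1) / ‖d‖, ht, rfl⟩, fun hmem => ?_⟩
    have h₁ := hC _ hmem
    have h₂ := norm_sub_le (p + ((2 * C + 1) / ‖d‖) • d) p
    rw [add_sub_cancel_left, norm_smul, Real.norm_of_nonneg ht,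
      div_mul_cancel₀ _ hdn.ne'] at h₂
    linarith [hC p hp]
  obtain ⟨_, ⟨t, ht, rfl⟩, hfr⟩ :=
    hpre.inter_frontier_nonempty ⟨p, ⟨0, self_mem_Ici, by simp⟩, hp⟩ hout
  exact ⟨t, ht, hfr⟩

section Triangle

variable {K : Set (ℝ × ℝ)} {u v a b : ℝ}

/-- The part of `↓k` beyond the line through `(u, b)` and `(a, v)` lies in the triangle spanned by
these two points and `k`. -/
theorem Convex.mem_of_le_of_above (hconv : Convex ℝ K) (hau : a < u) (hbv : b < v)
    (hP : (u, b) ∈ K) (hQ : (a, v) ∈ K) {k p : ℝ × ℝ} (hk : k ∈ K) (hku : k.1 ≤ u)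
    (hkv : k.2 ≤ v) (hpk : p ≤ k) (hp : (p.2 - b) * (a - u) ≤ (p.1 - u) * (v - b)) :
    p ∈ K := by
  obtain ⟨k₁, k₂⟩ := k
  obtain ⟨p₁, p₂⟩ := p
  obtain ⟨h₁, h₂⟩ := hpk
  simp only at *
  have hA : 0 < u - a := sub_pos.2 hau
  have hB : 0 < v - b := sub_pos.2 hbv
  obtain ⟨lp, hlp⟩ : ∃ l, l = (p₁ - u) * (v - b) + (p₂ - b) * (u - a) := ⟨_, rfl⟩
  obtain ⟨lk, hlk⟩ : ∃ l, l = (k₁ - u) * (v - b) + (k₂ - b) * (u - a) := ⟨_, rfl⟩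
  have hlp0 : 0 ≤ lp := by rw [hlp]; linarith
  have d₁ := mul_nonneg (sub_nonneg.2 h₁) hB.le
  have d₂ := mul_nonneg (sub_nonneg.2 h₂) hA.le
  have hle : lp ≤ lk := by rw [hlp, hlk]; linarith
  rcases (hlp0.trans hle).eq_or_lt with h0 | hlk0
  · have z₁ : (k₁ - p₁) * (v - b) = 0 := by linarith
    have z₂ : (k₂ - p₂) * (u - a) = 0 := by linarith
    have e₁ : k₁ = p₁ := by
      have := (mul_eq_zero.1 z₁).resolve_right hB.ne'; linarith
    have e₂ : k₂ = p₂ := by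
      have := (mul_eq_zero.1 z₂).resolve_right hA.ne'; linarith
    rwa [← e₁, ← e₂]
  · have hpa : a ≤ p₁ := by
      by_contra! hlt
      nlinarith [mul_pos (sub_pos.2 hlt) hB, mul_nonneg (sub_nonneg.2 (h₂.trans hkv)) hA.le]
    have hpb : b ≤ p₂ := by
      by_contra! hlt
      nlinarith [mul_pos (sub_pos.2 hlt) hA, mul_nonneg (sub_nonneg.2 (h₁.trans hku)) hB.le]
    have hw₂ : 0 ≤ ((k₁ - a) * (v - p₂) - (p₁ - a) * (v - k₂)) / lk := by
      refine div_nonneg (sub_nonneg.2 ?_) hlk0.le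
      apply mul_le_mul <;> linarith
    have hw₃ : 0 ≤ ((k₂ - b) * (u - p₁) - (p₂ - b) * (u - k₁)) / lk := by
      refine div_nonneg (sub_nonneg.2 ?_) hlk0.le
      apply mul_le_mul <;> linarith
    have key := hconv.combo_three_mem hk hP hQ (div_nonneg hlp0 hlk0.le) hw₂ hw₃ (by
      rw [← add_div, ← add_div, div_eq_one_iff_eq hlk0.ne', hlp, hlk]; ring)
    convert key using 1
    ext
    · simp only [Prod.smul_mk, Prod.mk_add_mk, smul_eq_mul]
      rw [div_mul_eq_mul_div, div_mul_eq_mul_div, div_mul_eq_mul_div, ← add_div, ← add_div,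
        eq_div_iff hlk0.ne', hlp, hlk]
      ring
    · simp only [Prod.smul_mk, Prod.mk_add_mk, smul_eq_mul]
      rw [div_mul_eq_mul_div, div_mul_eq_mul_div, div_mul_eq_mul_div, ← add_div, ← add_div,
        eq_div_iff hlk0.ne', hlp, hlk]
      ring

theorem Convex.mem_of_corner (hconv : Convex ℝ K) (hau : a < u) (hbv : b < v)
    (hP : (u, b) ∈ K) (hQ : (a, v) ∈ K) (hC : (a, b) ∈ K) {p : ℝ × ℝ} (hpa : a ≤ p.1)
    (hpb : b ≤ p.2) (hp : (p.1 - u) * (v - b) ≤ (p.2 - b) * (a - u)) : p ∈ K := by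
  have hA : 0 < u - a := sub_pos.2 hau
  have hB : 0 < v - b := sub_pos.2 hbv
  have hw : 0 ≤ 1 - (p.1 - a) / (u - a) - (p.2 - b) / (v - b) := by
    rw [sub_sub, sub_nonneg, div_add_div _ _ hA.ne' hB.ne', div_le_one (mul_pos hA hB)]
    linarith
  have key := hconv.combo_three_mem hC hP hQ hw (div_nonneg (sub_nonneg.2 hpa) hA.le)
    (div_nonneg (sub_nonneg.2 hpb) hB.le) (by ring)
  convert key using 1
  ext
  · simp only [Prod.smul_mk, Prod.mk_add_mk, smul_eq_mul]
    field_simp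
    ring
  · simp only [Prod.smul_mk, Prod.mk_add_mk, smul_eq_mul]
    field_simp
    ring

theorem mem_segment_of_on_line (hau : a < u) {p : ℝ × ℝ} (hpa : a ≤ p.1) (hpu : p.1 ≤ u)
    (hp : (p.2 - b) * (a - u) = (p.1 - u) * (v - b)) :
    p ∈ segment ℝ ((u, b) : ℝ × ℝ) (a, v) := by
  have hA : 0 < u - a := sub_pos.2 hau
  refine ⟨(p.1 - a) / (u - a), (u - p.1) / (u - a), div_nonneg (sub_nonneg.2 hpa) hA.le,
    div_nonneg (sub_nonneg.2 hpu) hA.le, by field_simp; ring, ?_⟩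
  ext
  · simp only [Prod.smul_mk, Prod.mk_add_mk, smul_eq_mul]
    field_simp
    ring
  · simp only [Prod.smul_mk, Prod.mk_add_mk, smul_eq_mul]
    field_simp
    linarith

theorem on_line_of_mem_segment {p : ℝ × ℝ} (hp : p ∈ segment ℝ ((u, b) : ℝ × ℝ) (a, v)) :
    (p.2 - b) * (a - u) = (p.1 - u) * (v - b) := by
  obtain ⟨r, t, -, -, h, rfl⟩ := hp
  simp only [Prod.smul_mk, Prod.mk_add_mk, smul_eq_mul]
  obtain rfl : r = 1 - t := by linarith
  ring

theorem left_notMem_openSegment (hau : a < u) :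
    ((u, b) : ℝ × ℝ) ∉ openSegment ℝ ((u, b) : ℝ × ℝ) (a, v) := by
  rw [left_mem_openSegment_iff]
  exact fun h => hau.ne' (Prod.ext_iff.1 h).1

theorem right_notMem_openSegment (hau : a < u) :
    ((a, v) : ℝ × ℝ) ∉ openSegment ℝ ((u, b) : ℝ × ℝ) (a, v) := by
  rw [openSegment_symm, left_mem_openSegment_iff]
  exact fun h => hau.ne (Prod.ext_iff.1 h).1

/-- A compact convex cap of the segment from `(u, b)` to `(a, v)` is the convex hull of its boundary
without the open segment. -/
theorem Convex.eq_convexHull_frontier_diff_openSegment {R : Set (ℝ × ℝ)} (hR : Convex ℝ R)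
    (hcl : IsClosed R) (hau : a < u) (hP : (u, b) ∈ R) (hQ : (a, v) ∈ R)
    (hRu : ∀ p ∈ R, p.1 ≤ u) (hRv : ∀ p ∈ R, p.2 ≤ v)
    (hRa : ∀ p ∈ R, a ≤ p.1) (hRb : ∀ p ∈ R, b ≤ p.2)
    (habove : ∀ p ∈ R, (p.2 - b) * (a - u) ≤ (p.1 - u) * (v - b)) :
    R = convexHull ℝ (frontier R \ openSegment ℝ ((u, b) : ℝ × ℝ) (a, v)) := by
  have hbdd : Bornology.IsBounded R :=
    (Metric.isBounded_Icc ((a, b) : ℝ × ℝ) (u, v)).subset fun p hp =>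
      ⟨⟨hRa p hp, hRb p hp⟩, hRu p hp, hRv p hp⟩
  refine Subset.antisymm (fun p hp => ?_)
    (convexHull_min (sdiff_subset.trans hcl.frontier_subset) hR)
  rcases (habove p hp).eq_or_lt with heq | hlt
  · have hfr : ∀ q ∈ R, (∀ ε > 0, (q.1 + ε, q.2 + ε) ∉ R) → q ∈ frontier R := fun q hq h => by
      rw [hcl.frontier_eq]
      refine ⟨hq, fun hint => ?_⟩
      obtain ⟨δ, hδ, hball⟩ := Metric.isOpen_iff.1 isOpen_interior q hint
      refine h (δ / 2) (half_pos hδ) (interior_subset (hball ?_))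
      rw [Metric.mem_ball, Prod.dist_eq, Real.dist_eq, Real.dist_eq]
      simp [abs_of_pos (half_pos hδ), hδ]
    have hP' : (u, b) ∈ frontier R \ openSegment ℝ ((u, b) : ℝ × ℝ) (a, v) :=
      ⟨hfr _ hP fun ε hε h => by linarith [hRu _ h], left_notMem_openSegment hau⟩
    have hQ' : (a, v) ∈ frontier R \ openSegment ℝ ((u, b) : ℝ × ℝ) (a, v) :=
      ⟨hfr _ hQ fun ε hε h => by linarith [hRv _ h], right_notMem_openSegment hau⟩
    exact (convex_convexHull ℝ _).segment_subset (subset_convexHull ℝ _ hP')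
      (subset_convexHull ℝ _ hQ') (mem_segment_of_on_line hau (hRa p hp) (hRu p hp) heq)
  · have hmem : ∀ t : ℝ, p + t • ((u - a, b - v) : ℝ × ℝ) ∈ frontier R →
        p + t • ((u - a, b - v) : ℝ × ℝ) ∈
          frontier R \ openSegment ℝ ((u, b) : ℝ × ℝ) (a, v) := fun t ht => by
      refine ⟨ht, fun hseg => hlt.ne ?_⟩
      have := on_line_of_mem_segment (openSegment_subset_segment ℝ _ _ hseg)
      simp only [Prod.fst_add, Prod.snd_add, Prod.smul_mk, smul_eq_mul] at this
      linarith
    have hd : ((u - a, b - v) : ℝ × ℝ) ≠ 0 := fun h =>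
      (sub_pos.2 hau).ne' (Prod.ext_iff.1 h).1
    obtain ⟨t, ht, h₁⟩ := hbdd.exists_add_smul_mem_frontier hp hd
    obtain ⟨s, hs, h₂⟩ := hbdd.exists_add_smul_mem_frontier hp (neg_ne_zero.2 hd)
    rw [smul_neg, ← neg_smul] at h₂
    have m₁ := subset_convexHull ℝ _ (hmem _ h₁)
    have m₂ := subset_convexHull ℝ _ (hmem _ h₂)
    rcases (add_nonneg ht hs).eq_or_lt with h0 | h0
    · have : t = 0 := by linarith
      simpa [this] using m₁
    · refine (convex_convexHull ℝ _).segment_subset m₁ m₂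
        ⟨s / (t + s), t / (t + s), by positivity, by positivity, by field_simp; ring, ?_⟩
      ext
      · simp only [Prod.fst_add, Prod.smul_fst, smul_eq_mul]
        field_simp
        ring
      · simp only [Prod.snd_add, Prod.smul_snd, smul_eq_mul]
        field_simp
        ring

/-- A convex set containing a quadrant contains everything strictly below any of its points. -/
theorem Convex.mem_of_Iic_subset (hconv : Convex ℝ K) {x m c : ℝ × ℝ} (hx : Iic x ⊆ K)
    (hm : m ∈ K) (h₁ : c.1 < m.1) (h₂ : c.2 < m.2) : c ∈ K := by
  obtain ⟨n, hn₁, hn₂, hn⟩ : ∃ n : ℝ, (m.1 - x.1) / (m.1 - c.1) ≤ n ∧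
      (m.2 - x.2) / (m.2 - c.2) ≤ n ∧ 1 ≤ n :=
    ⟨max (max ((m.1 - x.1) / (m.1 - c.1)) ((m.2 - x.2) / (m.2 - c.2))) 1, by simp, by simp,
      by simp⟩
  rw [div_le_iff₀ (sub_pos.2 h₁)] at hn₁
  rw [div_le_iff₀ (sub_pos.2 h₂)] at hn₂
  have hn0 : 0 < n := by linarith
  have hy : m + n • (c - m) ∈ K := by
    refine hx ⟨?_, ?_⟩
    · simp only [Prod.fst_add, Prod.smul_fst, Prod.fst_sub, smul_eq_mul]; linarith
    · simp only [Prod.snd_add, Prod.smul_snd, Prod.snd_sub, smul_eq_mul]; linarith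
  refine hconv.segment_subset hm hy ⟨1 - 1 / n, 1 / n, ?_, by positivity, by ring, ?_⟩
  · rw [sub_nonneg, div_le_one hn0]; exact hn
  · rw [smul_add, smul_smul, one_div_mul_cancel hn0.ne', ← add_assoc, ← add_smul]
    simp

end Triangle

/-- `R_K = co F_K`, and if `K` has nonempty `q`-interior then
`S_K = co (F_K ∪ {(α,β)})`, for a nonempty `q`-compact convex `K ⊆ ℝ²` with `(α,v) ≠ (u,β)`. -/
theorem RK_eq_convexHull_FK
    (N : ℝ × ℝ → ℝ)
    (hN0 : ∀ x : ℝ × ℝ, N x = 0 ↔ x = 0)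
    (hNs : ∀ (c : ℝ) (x : ℝ × ℝ), N (c • x) = |c| * N x)
    (hNt : ∀ x y : ℝ × ℝ, N (x + y) ≤ N x + N y)
    (hNl : ∀ x y : ℝ × ℝ, |x.1| ≤ |y.1| → |x.2| ≤ |y.2| → N x ≤ N y)
    (K : Set (ℝ × ℝ)) (hne : K.Nonempty) (hconv : Convex ℝ K)
    (hcomp : @IsCompact _ (ballTop (q2 N)) K)
    (u v a b : ℝ)
    (hu : u = sSup (Prod.fst '' K)) (hv : v = sSup (Prod.snd '' K))
    (ha : a = sSup {x : ℝ | (x, v) ∈ K}) (hb : b = sSup {y : ℝ | (u, y) ∈ K})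
    (hab : ((a, v) : ℝ × ℝ) ≠ (u, b))
    (R F : Set (ℝ × ℝ))
    (hR : R = K ∩ {p : ℝ × ℝ | (p.2 - b) * (a - u) ≤ (p.1 - u) * (v - b)})
    (hF : (R = segment ℝ ((u, b) : ℝ × ℝ) (a, v) ∧ F = segment ℝ ((u, b) : ℝ × ℝ) (a, v)) ∨
          (R ≠ segment ℝ ((u, b) : ℝ × ℝ) (a, v) ∧
            F = frontier (closure R) \ openSegment ℝ ((u, b) : ℝ × ℝ) (a, v))) :
    R = convexHull ℝ F ∧
      ((@interior _ (ballTop (q2 N)) K).Nonempty →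
        K ∩ ((Set.univ : Set ℝ) ×ˢ Set.Ici b) ∩ (Set.Ici a ×ˢ (Set.univ : Set ℝ)) =
          convexHull ℝ (F ∪ {((a, b) : ℝ × ℝ)})) := by
  have hmax : ∀ f : ℝ × ℝ → ℝ, Continuous f → Monotone f → ∃ k ∈ K, ∀ x ∈ K, f x ≤ f k :=
    fun f hf hmono => exists_max_of_isCompact_ballTop_q2 hN0 hNs hNl hne hcomp hf hmono
  have hmin : ∀ c : ℝ × ℝ, ∃ k ∈ K, ∀ x ∈ K,
      min (x.1 - c.1) (x.2 - c.2) ≤ min (k.1 - c.1) (k.2 - c.2) := fun c =>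
    hmax (fun x => min (x.1 - c.1) (x.2 - c.2)) (by fun_prop)
      fun x y hxy => min_le_min (sub_le_sub_right hxy.1 _) (sub_le_sub_right hxy.2 _)
  obtain ⟨ku, hkuK, hku⟩ := hmax Prod.fst continuous_fst monotone_fst
  obtain ⟨kv, hkvK, hkv⟩ := hmax Prod.snd continuous_snd monotone_snd
  have hu' : u = ku.1 := hu.trans
    (IsGreatest.csSup_eq ⟨mem_image_of_mem _ hkuK, by rintro _ ⟨x, hx, rfl⟩; exact hku x hx⟩)
  have hv' : v = kv.2 := hv.trans
    (IsGreatest.csSup_eq ⟨mem_image_of_mem _ hkvK, by rintro _ ⟨x, hx, rfl⟩; exact hkv x hx⟩)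
  have hKu : ∀ x ∈ K, x.1 ≤ u := by rwa [hu']
  have hKv : ∀ x ∈ K, x.2 ≤ v := by rwa [hv']
  have hbdda : BddAbove {x : ℝ | (x, v) ∈ K} := ⟨u, fun x hx => hKu _ hx⟩
  have hbddb : BddAbove {y : ℝ | (u, y) ∈ K} := ⟨v, fun x hx => hKv _ hx⟩
  have hnea : {x : ℝ | (x, v) ∈ K}.Nonempty := ⟨kv.1, by rw [hv']; exact hkvK⟩
  have hneb : {y : ℝ | (u, y) ∈ K}.Nonempty := ⟨ku.2, by rw [hu']; exact hkuK⟩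
  have hQ : (a, v) ∈ K := by
    obtain ⟨k, hk, hkm⟩ := hmin (a, v)
    have h0 : 0 ≤ min (k.1 - a) (k.2 - v) := by
      by_contra! hneg
      obtain ⟨x, hx, hlt⟩ := exists_lt_of_lt_csSup hnea
        (show a + min (k.1 - a) (k.2 - v) < sSup {x : ℝ | (x, v) ∈ K} by rw [← ha]; linarith)
      have := hkm _ hx
      simp only [sub_self] at this
      rcases min_le_iff.1 this with h | h <;> linarith
    obtain ⟨h₁, h₂⟩ := le_min_iff.1 h0
    have e₂ : k.2 = v := le_antisymm (hKv k hk) (by linarith)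
    have e₁ : k.1 = a := le_antisymm
      (ha ▸ le_csSup hbdda (show (k.1, v) ∈ K by rw [← e₂]; exact hk)) (by linarith)
    rw [← e₁, ← e₂]
    exact hk
  have hP : (u, b) ∈ K := by
    obtain ⟨k, hk, hkm⟩ := hmin (u, b)
    have h0 : 0 ≤ min (k.1 - u) (k.2 - b) := by
      by_contra! hneg
      obtain ⟨x, hx, hlt⟩ := exists_lt_of_lt_csSup hneb
        (show b + min (k.1 - u) (k.2 - b) < sSup {y : ℝ | (u, y) ∈ K} by rw [← hb]; linarith)
      have := hkm _ hx
      simp only [sub_self] at this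
      rcases min_le_iff.1 this with h | h <;> linarith
    obtain ⟨h₁, h₂⟩ := le_min_iff.1 h0
    have e₁ : k.1 = u := le_antisymm (hKu k hk) (by linarith)
    have e₂ : k.2 = b := le_antisymm
      (hb ▸ le_csSup hbddb (show (u, k.2) ∈ K by rw [← e₁]; exact hk)) (by linarith)
    rw [← e₁, ← e₂]
    exact hk
  have hau : a < u := by
    refine lt_of_le_of_ne (hKu _ hQ) fun h => hab ?_
    have : v ≤ b := hb ▸ le_csSup hbddb (show (u, v) ∈ K from h ▸ hQ)
    rw [h, le_antisymm this (hKv _ hP)]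
  have hbv : b < v := by
    refine lt_of_le_of_ne (hKv _ hP) fun h => hab ?_
    have : u ≤ a := ha ▸ le_csSup hbdda (show (u, v) ∈ K from h ▸ hP)
    rw [← h, le_antisymm this (hKu _ hQ)]
  have hlow : IsClosed (lowerClosure K : Set (ℝ × ℝ)) := by
    rw [← isOpen_compl_iff, isOpen_iff_forall_mem_open]
    intro p hp
    obtain ⟨k, hk, hkm⟩ := hmin p
    have hneg : min (k.1 - p.1) (k.2 - p.2) < 0 := by
      by_contra! h
      obtain ⟨h₁, h₂⟩ := le_min_iff.1 h
      exact hp (mem_lowerClosure.2 ⟨k, hk, by linarith, by linarith⟩)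
    refine ⟨{q | p.1 + min (k.1 - p.1) (k.2 - p.2) < q.1 ∧
      p.2 + min (k.1 - p.1) (k.2 - p.2) < q.2}, ?_, ?_, by linarith, by linarith⟩
    · rintro q ⟨h₁, h₂⟩ hq
      obtain ⟨x, hx, hqx₁, hqx₂⟩ := mem_lowerClosure.1 hq
      rcases min_le_iff.1 (hkm x hx) with h | h <;> linarith
    · exact (isOpen_lt continuous_const continuous_fst).inter
        (isOpen_lt continuous_const continuous_snd)
  have hHcl : IsClosed {p : ℝ × ℝ | (p.2 - b) * (a - u) ≤ (p.1 - u) * (v - b)} :=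
    isClosed_le (by fun_prop) (by fun_prop)
  have hRlow : R = (lowerClosure K : Set (ℝ × ℝ)) ∩
      {p : ℝ × ℝ | (p.2 - b) * (a - u) ≤ (p.1 - u) * (v - b)} := by
    rw [hR]
    refine Subset.antisymm (inter_subset_inter_left _ subset_lowerClosure) ?_
    rintro p ⟨hp, hpH⟩
    obtain ⟨k, hk, hpk⟩ := mem_lowerClosure.1 hp
    exact ⟨hconv.mem_of_le_of_above hau hbv hP hQ hk (hKu k hk) (hKv k hk) hpk hpH, hpH⟩
  have hRcl : IsClosed R := hRlow ▸ hlow.inter hHcl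
  have hRK : R ⊆ K := hR ▸ inter_subset_left
  have hRH : ∀ p ∈ R, (p.2 - b) * (a - u) ≤ (p.1 - u) * (v - b) := fun p hp => by
    rw [hR] at hp; exact hp.2
  have hHconv : Convex ℝ {p : ℝ × ℝ | (p.2 - b) * (a - u) ≤ (p.1 - u) * (v - b)} := by
    intro x hx y hy r t hr ht hrt
    simp only [mem_ofPred_eq, Prod.fst_add, Prod.snd_add, Prod.smul_fst, Prod.smul_snd,
      smul_eq_mul] at *
    obtain rfl : r = 1 - t := by linarith
    linarith [mul_le_mul_of_nonneg_left hx hr, mul_le_mul_of_nonneg_left hy ht]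
  have hRconv : Convex ℝ R := hR ▸ hconv.inter hHconv
  have hPR : (u, b) ∈ R := by rw [hR]; exact ⟨hP, by simp⟩
  have hQR : (a, v) ∈ R := by rw [hR]; exact ⟨hQ, by simp [mul_comm]⟩
  have hRa : ∀ p ∈ R, a ≤ p.1 := fun p hp => by
    by_contra! hlt
    nlinarith [hRH p hp, mul_pos (sub_pos.2 hlt) (sub_pos.2 hbv),
      mul_nonneg (sub_nonneg.2 (hKv p (hRK hp))) (sub_pos.2 hau).le]
  have hRb : ∀ p ∈ R, b ≤ p.2 := fun p hp => by
    by_contra! hlt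
    nlinarith [hRH p hp, mul_pos (sub_pos.2 hlt) (sub_pos.2 hau),
      mul_nonneg (sub_nonneg.2 (hKu p (hRK hp))) (sub_pos.2 hbv).le]
  have hmain : R = convexHull ℝ F := by
    rcases hF with ⟨hRseg, hFseg⟩ | ⟨-, hFfr⟩
    · rw [hFseg, (convex_segment _ _).convexHull_eq, hRseg]
    · rw [hFfr, hRcl.closure_eq]
      exact hRconv.eq_convexHull_frontier_diff_openSegment hRcl hau hPR hQR
        (fun p hp => hKu p (hRK hp)) (fun p hp => hKv p (hRK hp)) hRa hRb hRH
  refine ⟨hmain, fun hint => ?_⟩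
  obtain ⟨x, hx⟩ := exists_Iic_subset_of_interior_ballTop_q2 hN0 hint
  have hFR : F ⊆ R := hmain ▸ subset_convexHull ℝ F
  have hRhull : R ⊆ convexHull ℝ (F ∪ {((a, b) : ℝ × ℝ)}) := by
    rw [hmain]; exact convexHull_mono subset_union_left
  refine Subset.antisymm ?_ (convexHull_min (union_subset (fun p hp => ?_) ?_) ?_)
  · rintro p ⟨⟨hpK, -, hpb⟩, hpa, -⟩
    rcases le_total ((p.2 - b) * (a - u)) ((p.1 - u) * (v - b)) with h | h
    · exact hRhull (by rw [hR]; exact ⟨hpK, h⟩)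
    · exact (convex_convexHull ℝ _).mem_of_corner hau hbv (hRhull hPR) (hRhull hQR)
        (subset_convexHull ℝ _ (Or.inr rfl)) hpa hpb h
  · exact ⟨⟨hRK (hFR hp), trivial, hRb p (hFR hp)⟩, hRa p (hFR hp), trivial⟩
  · rw [singleton_subset_iff]
    refine ⟨⟨?_, trivial, self_mem_Ici⟩, self_mem_Ici, trivial⟩
    refine hconv.mem_of_Iic_subset hx
      (hconv hP hQ (a := 1 / 2) (b := 1 / 2) (by norm_num) (by norm_num) (by norm_num)) ?_ ?_
    · simp only [Prod.smul_mk, Prod.mk_add_mk, smul_eq_mul]; linarith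
    · simp only [Prod.smul_mk, Prod.mk_add_mk, smul_eq_mul]; linarith
  · exact (hconv.inter (convex_univ.prod (convex_Ici b))).inter ((convex_Ici a).prod convex_univ)
end
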